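/- arXiv:2003.14241 — 3 statements merged into one kernel-verified Lean document; each statement's English description precedes it below -/
import Mathlib

section
/- For every natural number r, the (2r)-th derivative of ξ at s = 1/2 is a positive real number (zero imaginary part and positive real part), and every odd-order derivative of ξ at s = 1/2 vanishes. -/
open Complex

/-- The Riemann xi function: `ξ(s) = (s(s-1)/2)·Λ₀(s) + 1/2`. -/
noncomputable def xi (s : ℂ) : ℂ := s * (s - 1) / 2 * completedRiemannZeta₀ s + 1 / 2

/-- `ξ_r = ξ^{(2r)}(1/2) / (2r)!`. -/
noncomputable def xiCoeff (r : ℕ) : ℂ := iteratedDeriv (2 * r) xi (1 / 2) / ((2 * r).factorial : ℂ)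

/-- `ξ₊(s) = (1/2)(ξ(s+1/2) + ξ(s−1/2))`. -/
noncomputable def xiPlus (s : ℂ) : ℂ := (1 / 2) * (xi (s + 1 / 2) + xi (s - 1 / 2))

/-- `ξ₋(s) = (1/2)(ξ(s+1/2) − ξ(s−1/2))`. -/
noncomputable def xiMinus (s : ℂ) : ℂ := (1 / 2) * (xi (s + 1 / 2) - xi (s - 1 / 2))

section Theta

open MeasureTheory Filter Set Asymptotics Topology

/-- `∑ₙ (π n²)ᵏ exp(-π n² t)` over the integers: up to sign, the `k`-th derivative of the theta
series. -/
noncomputable def thetaMoment (k : ℕ) (t : ℝ) : ℝ :=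
  ∑' n : ℤ, (Real.pi * (n : ℝ) ^ 2) ^ k * Real.exp (-(Real.pi * (n : ℝ) ^ 2) * t)

lemma summable_thetaMoment (k : ℕ) {t : ℝ} (ht : 0 < t) :
    Summable fun n : ℤ ↦
      (Real.pi * (n : ℝ) ^ 2) ^ k * Real.exp (-(Real.pi * (n : ℝ) ^ 2) * t) := by
  refine ((summable_pow_mul_jacobiTheta₂_term_bound 0 ht (2 * k)).mul_left
    (Real.pi ^ k)).congr fun n ↦ ?_
  have h : ((|n| : ℤ) : ℝ) ^ (2 * k) = ((n : ℝ) ^ 2) ^ k := by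
    rw [pow_mul, Int.cast_abs, sq_abs]
  rw [h, mul_pow, ← mul_assoc]
  congr 2
  ring

lemma hasDerivAt_thetaMoment (k : ℕ) {t : ℝ} (ht : 0 < t) :
    HasDerivAt (thetaMoment k) (-thetaMoment (k + 1) t) t := by
  have key := hasDerivAt_tsum_of_isPreconnected
    (g := fun (n : ℤ) (y : ℝ) ↦
      (Real.pi * (n : ℝ) ^ 2) ^ k * Real.exp (-(Real.pi * (n : ℝ) ^ 2) * y))
    (g' := fun (n : ℤ) (y : ℝ) ↦
      -((Real.pi * (n : ℝ) ^ 2) ^ (k + 1) * Real.exp (-(Real.pi * (n : ℝ) ^ 2) * y)))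
    (summable_thetaMoment (k + 1) (half_pos ht)) isOpen_Ioi isPreconnected_Ioi (y₀ := t) (y := t)
    (fun n y _ ↦ ?_) (fun n y hy ↦ ?_) (half_lt_self ht) (summable_thetaMoment k ht)
    (half_lt_self ht)
  · rwa [tsum_neg] at key
  · convert! ((((hasDerivAt_id y).const_mul (-(Real.pi * (n : ℝ) ^ 2))).exp).const_mul
      ((Real.pi * (n : ℝ) ^ 2) ^ k)) using 1
    simp only [id, mul_one]
    ring
  · rw [norm_neg, Real.norm_of_nonneg (by positivity)]
    have h : t / 2 ≤ y := (mem_Ioi.1 hy).le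
    have : 0 ≤ Real.pi * (n : ℝ) ^ 2 := by positivity
    exact mul_le_mul_of_nonneg_left (Real.exp_le_exp.2 (by nlinarith)) (by positivity)

lemma thetaMoment_nonneg (k : ℕ) (t : ℝ) : 0 ≤ thetaMoment k t :=
  tsum_nonneg fun n ↦ by positivity

lemma one_le_pi_mul_int_sq {n : ℤ} (hn : n ≠ 0) : Real.pi ≤ Real.pi * (n : ℝ) ^ 2 := by
  have : (1 : ℝ) ≤ (n : ℝ) ^ 2 := by
    rw [← sq_abs]
    exact one_le_pow₀ (mod_cast Int.one_le_abs hn)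
  nlinarith [Real.pi_pos]

lemma thetaMoment_succ_le_exp (k : ℕ) {t : ℝ} (ht : 1 / 2 ≤ t) :
    thetaMoment (k + 1) t ≤ thetaMoment (k + 1) (1 / 2) * Real.exp (-(t - 1 / 2)) := by
  rw [thetaMoment, thetaMoment, ← tsum_mul_right]
  refine (summable_thetaMoment _ (by linarith)).tsum_le_tsum (fun n ↦ ?_)
    ((summable_thetaMoment _ (by norm_num)).mul_right _)
  rcases eq_or_ne n 0 with rfl | hn
  · simp
  rw [mul_assoc, ← Real.exp_add]
  have := one_le_pi_mul_int_sq hn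
  gcongr
  nlinarith [Real.pi_gt_three]

lemma thetaMoment_succ_le_inv_pow (k : ℕ) {t : ℝ} (ht : 0 < t) :
    thetaMoment (k + 1) t ≤
      ((k + 2).factorial * ∑' n : ℤ, 1 / (n : ℝ) ^ 2) * (t ^ (k + 2))⁻¹ := by
  have hs : Summable fun n : ℤ ↦ 1 / (n : ℝ) ^ 2 :=
    Real.summable_one_div_int_pow.2 one_lt_two
  rw [thetaMoment, ← tsum_mul_left, ← tsum_mul_right]
  refine (summable_thetaMoment _ ht).tsum_le_tsum (fun n ↦ ?_)
    ((hs.mul_left _).mul_right _)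
  rcases eq_or_ne n 0 with rfl | hn
  · simp
  have hn' : 0 < (n : ℝ) ^ 2 := by positivity
  have ha := one_le_pi_mul_int_sq hn
  set a := Real.pi * (n : ℝ) ^ 2
  have ha0 : 0 < a := Real.pi_pos.trans_le ha
  have hle := Real.pow_div_factorial_le_exp (x := a * t) (by positivity) (k + 2)
  have hna : (n : ℝ) ^ 2 ≤ a := by nlinarith [Real.pi_gt_three]
  rw [neg_mul, Real.exp_neg]
  calc a ^ (k + 1) * (Real.exp (a * t))⁻¹
      ≤ a ^ (k + 1) * ((a * t) ^ (k + 2) / (k + 2).factorial)⁻¹ := by gcongr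
    _ = (k + 2).factorial * (1 / a) * (t ^ (k + 2))⁻¹ := by
        field_simp
        ring
    _ ≤ _ := by gcongr

lemma thetaMoment_zero_inv {t : ℝ} (ht : 0 < t) :
    thetaMoment 0 t = t ^ (-(1 / 2) : ℝ) * thetaMoment 0 t⁻¹ := by
  have := Real.tsum_exp_neg_mul_int_sq ht
  simp only [thetaMoment, pow_zero, one_mul]
  rw [Real.rpow_neg ht.le, ← one_div]
  refine (tsum_congr fun n ↦ ?_).trans
    (this.trans (congrArg _ (tsum_congr fun n ↦ ?_))) <;> ring_nf

lemma hasDerivAt_rpow_mul_thetaMoment_inv (r : ℝ) (k : ℕ) {t : ℝ} (ht : 0 < t) :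
    HasDerivAt (fun x ↦ x ^ r * thetaMoment k x⁻¹)
      (r * (t ^ (r - 1) * thetaMoment k t⁻¹) + t ^ (r - 2) * thetaMoment (k + 1) t⁻¹) t := by
  have h1 := (Real.hasDerivAt_rpow_const (p := r) (Or.inl ht.ne')).mul
    ((hasDerivAt_thetaMoment k (inv_pos.2 ht)).comp t (hasDerivAt_inv ht.ne'))
  convert! h1 using 1
  rw [show r - 2 = r - (2 : ℕ) by norm_num, Real.rpow_sub_natCast ht.ne']
  simp only [Function.comp]
  field_simp

lemma thetaMoment_one_inv {t : ℝ} (ht : 0 < t) :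
    thetaMoment 1 t = 1 / 2 * (t ^ (-(3 / 2) : ℝ) * thetaMoment 0 t⁻¹)
      - t ^ (-(5 / 2) : ℝ) * thetaMoment 1 t⁻¹ := by
  have h := ((hasDerivAt_rpow_mul_thetaMoment_inv (-(1 / 2)) 0 ht).congr_of_eventuallyEq
    ((eventually_gt_nhds ht).mono fun x hx ↦ thetaMoment_zero_inv hx)).unique
    (hasDerivAt_thetaMoment 0 ht)
  norm_num at h ⊢
  linarith

lemma thetaMoment_two_inv {t : ℝ} (ht : 0 < t) :
    thetaMoment 2 t = 3 / 4 * (t ^ (-(5 / 2) : ℝ) * thetaMoment 0 t⁻¹)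
      - 3 * (t ^ (-(7 / 2) : ℝ) * thetaMoment 1 t⁻¹)
      + t ^ (-(9 / 2) : ℝ) * thetaMoment 2 t⁻¹ := by
  have h := ((((hasDerivAt_rpow_mul_thetaMoment_inv (-(3 / 2)) 0 ht).const_mul (1 / 2)).sub
    (hasDerivAt_rpow_mul_thetaMoment_inv (-(5 / 2)) 1 ht)).congr_of_eventuallyEq
    ((eventually_gt_nhds ht).mono fun x hx ↦ thetaMoment_one_inv hx)).unique
    (hasDerivAt_thetaMoment 1 ht)
  norm_num at h ⊢
  linarith

/-- The kernel whose Mellin transform is the Riemann xi function. -/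
noncomputable def xiKernel (t : ℝ) : ℝ :=
  t ^ 2 * thetaMoment 2 t - 3 / 2 * (t * thetaMoment 1 t)

lemma xiKernel_inv {t : ℝ} (ht : 0 < t) :
    xiKernel t = t ^ (-(1 / 2) : ℝ) * xiKernel t⁻¹ := by
  have e (m : ℕ) : t ^ (-(1 / 2) - (m : ℝ)) = t ^ (-(1 / 2) : ℝ) / t ^ m :=
    Real.rpow_sub_natCast ht.ne' _ m
  have e1 := e 1
  have e2 := e 2
  have e3 := e 3
  have e4 := e 4
  norm_num at e1 e2 e3 e4
  rw [xiKernel, xiKernel, thetaMoment_one_inv ht, thetaMoment_two_inv ht]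
  norm_num
  rw [e1, e2, e3, e4]
  field_simp
  ring

lemma xiKernel_pos {t : ℝ} (ht : 0 < t) : 0 < xiKernel t := by
  wlog h : 1 ≤ t generalizing t
  · rw [xiKernel_inv ht]
    exact mul_pos (Real.rpow_pos_of_pos ht _)
      (this (inv_pos.2 ht) ((one_le_inv₀ ht).2 (not_le.1 h).le))
  have hs2 := (summable_thetaMoment 2 ht).mul_left (t ^ 2)
  have hs1 := ((summable_thetaMoment 1 ht).mul_left t).mul_left (3 / 2)
  rw [xiKernel, thetaMoment, thetaMoment, ← tsum_mul_left, ← tsum_mul_left, ← tsum_mul_left,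
    ← hs2.tsum_sub hs1]
  have hpos (n : ℤ) (hn : n ≠ 0) :
      0 < t ^ 2 * ((Real.pi * (n : ℝ) ^ 2) ^ 2 * Real.exp (-(Real.pi * (n : ℝ) ^ 2) * t)) -
        3 / 2 * (t * ((Real.pi * (n : ℝ) ^ 2) ^ 1 *
          Real.exp (-(Real.pi * (n : ℝ) ^ 2) * t))) := by
    have ha := one_le_pi_mul_int_sq hn
    set a := Real.pi * (n : ℝ) ^ 2
    have hat : 3 / 2 < a * t := by nlinarith [Real.pi_gt_three]
    have : 0 < a * t * (a * t - 3 / 2) * Real.exp (-a * t) :=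
      mul_pos (mul_pos (by linarith) (by linarith)) (Real.exp_pos _)
    linarith
  refine (hs2.sub hs1).tsum_pos (fun n ↦ ?_) 1 (hpos 1 one_ne_zero)
  rcases eq_or_ne n 0 with rfl | hn
  · simp
  · exact (hpos n hn).le

lemma continuousOn_xiKernel : ContinuousOn xiKernel (Ioi 0) := by
  have h (k : ℕ) : ContinuousOn (thetaMoment k) (Ioi 0) := fun t ht ↦
    (hasDerivAt_thetaMoment k ht).continuousAt.continuousWithinAt
  exact ((continuousOn_id.pow 2).mul (h 2)).sub (continuousOn_const.mul (continuousOn_id.mul (h 1)))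

lemma thetaMoment_succ_isBigO_atTop (k : ℕ) (r : ℝ) :
    thetaMoment (k + 1) =O[atTop] fun t ↦ t ^ r := by
  have h1 : thetaMoment (k + 1) =O[atTop] fun t ↦ Real.exp (-1 * t) := by
    refine .of_bound (thetaMoment (k + 1) (1 / 2) * Real.exp (1 / 2)) ?_
    filter_upwards [eventually_ge_atTop (1 / 2 : ℝ)] with t ht
    rw [Real.norm_of_nonneg (thetaMoment_nonneg _ _), Real.norm_of_nonneg (Real.exp_nonneg _),
      mul_assoc, ← Real.exp_add]
    convert! thetaMoment_succ_le_exp k ht using 3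
    ring
  exact h1.trans (isLittleO_exp_neg_mul_rpow_atTop one_pos r).isBigO

lemma thetaMoment_succ_isBigO_zero (k : ℕ) :
    thetaMoment (k + 1) =O[𝓝[>] 0] fun t ↦ t ^ (-(k + 2 : ℝ)) := by
  refine .of_bound ((k + 2).factorial * ∑' n : ℤ, 1 / (n : ℝ) ^ 2) ?_
  filter_upwards [self_mem_nhdsWithin] with t ht
  have ht' : 0 < t := ht
  rw [Real.norm_of_nonneg (thetaMoment_nonneg _ _), Real.norm_of_nonneg (by positivity),
    Real.rpow_neg ht'.le, show (k + 2 : ℝ) = ((k + 2 : ℕ) : ℝ) by push_cast; ring,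
    Real.rpow_natCast]
  exact thetaMoment_succ_le_inv_pow k ht

lemma xiKernel_isBigO_atTop (r : ℝ) : xiKernel =O[atTop] fun t ↦ t ^ r := by
  have h (k m : ℕ) : (fun t ↦ t ^ m * thetaMoment (k + 1) t) =O[atTop] fun t : ℝ ↦ t ^ r := by
    refine ((isBigO_refl (fun t : ℝ ↦ t ^ m) atTop).mul
      (thetaMoment_succ_isBigO_atTop k (r - m))).congr' .rfl ?_
    filter_upwards [eventually_gt_atTop 0] with t ht
    rw [← Real.rpow_natCast, ← Real.rpow_add ht, add_sub_cancel]
  simpa [xiKernel] using! (h 1 2).sub ((h 0 1).const_mul_left (3 / 2))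

lemma xiKernel_isBigO_zero (r : ℝ) : xiKernel =O[𝓝[>] 0] fun t ↦ t ^ r := by
  have h := (isBigO_refl (fun t : ℝ ↦ t ^ (-(1 / 2) : ℝ)) (𝓝[>] 0)).mul
    ((xiKernel_isBigO_atTop (-(1 / 2) - r)).comp_tendsto tendsto_inv_nhdsGT_zero)
  refine h.congr' ?_ ?_
  · filter_upwards [self_mem_nhdsWithin] with t ht
    exact (xiKernel_inv ht).symm
  · filter_upwards [self_mem_nhdsWithin] with t ht
    have ht' : 0 < t := ht
    simp only [Function.comp]
    rw [Real.inv_rpow ht'.le, ← Real.rpow_neg ht'.le, ← Real.rpow_add ht']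
    congr 1
    ring

lemma Gammaℝ_mul_mellin_thetaMoment_succ (k : ℕ) {s : ℂ} (hs : 1 < s.re) :
    Gammaℝ s * mellin (fun t ↦ (thetaMoment (k + 1) t : ℂ)) (s / 2 + (k + 1 : ℕ)) =
      2 * Real.pi ^ (k + 1) * Gammaℝ (s + 2 * (k + 1 : ℕ)) * completedRiemannZeta s := by
  have hre : (s + 2 * (k + 1 : ℕ)).re = s.re + (2 * (k + 1) : ℕ) := by
    rw [← Nat.cast_ofNat (n := 2), ← Nat.cast_mul, add_re, natCast_re]
  have h := hasSum_mellin_pi_mul_sq (a := fun n : ℤ ↦ (((Real.pi * (n : ℝ) ^ 2) ^ (k + 1) : ℝ) : ℂ))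
    (r := fun n : ℤ ↦ (n : ℝ)) (F := fun t ↦ (thetaMoment (k + 1) t : ℂ))
    (s := s + 2 * (k + 1 : ℕ)) (by rw [hre]; positivity) (fun t ht ↦ ?_) ?_
  · have hz := HurwitzZeta.hasSum_int_completedCosZeta 0 hs
    rw [show ((0 : ℝ) : UnitAddCircle) = 0 from rfl, HurwitzZeta.completedCosZeta_zero] at hz
    rw [show (s + 2 * (k + 1 : ℕ)) / 2 = s / 2 + (k + 1 : ℕ) by ring] at h
    refine (h.mul_left (Gammaℝ s)).unique ((hz.mul_left
      (2 * Real.pi ^ (k + 1) * Gammaℝ (s + 2 * (k + 1 : ℕ)))).congr_fun fun n ↦ ?_)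
    rcases eq_or_ne n 0 with rfl | hn
    · have : s ≠ 0 := fun h0 ↦ by norm_num [h0] at hs
      simp [this]
    have hn' : ((|(n : ℝ)| : ℝ) : ℂ) ≠ 0 := by simpa using hn
    have hpow : ((|(n : ℝ)| : ℝ) : ℂ) ^ (s + 2 * (k + 1 : ℕ)) =
        ((|(n : ℝ)| : ℝ) : ℂ) ^ s * ((n : ℂ) ^ 2) ^ (k + 1) := by
      rw [cpow_add _ _ hn', ← Nat.cast_ofNat (n := 2), ← Nat.cast_mul, cpow_natCast, pow_mul,
        ← ofReal_pow, sq_abs]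
      push_cast
      rfl
    rw [hpow]
    have h1 : ((n : ℂ) ^ 2) ^ (k + 1) ≠ 0 := by simpa using hn
    have h2 : ((|(n : ℝ)| : ℝ) : ℂ) ^ s ≠ 0 := by simp [cpow_eq_zero_iff, hn]
    rw [show ((|n| : ℤ) : ℂ) = ((|(n : ℝ)| : ℝ) : ℂ) by rw [← Int.cast_abs]; norm_cast]
    push_cast
    simp only [mul_zero, zero_mul, Complex.exp_zero, mul_one, mul_pow]
    field_simp
  · have := (summable_thetaMoment (k + 1) ht).hasSum
    refine (hasSum_ofReal.2 this).congr_fun fun n ↦ ?_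
    split_ifs with h0
    · simp [h0]
    · push_cast
      ring_nf
  · refine (((Real.summable_one_div_int_add_rpow 0 s.re).2 hs).mul_left
      (Real.pi ^ (k + 1))).congr fun n ↦ ?_
    rcases eq_or_ne n 0 with rfl | hn
    · simp [Real.zero_rpow (by linarith : s.re ≠ 0)]
    have hn' : 0 < |(n : ℝ)| := by simpa using hn
    rw [hre, Real.rpow_add_natCast hn'.ne', norm_real, Real.norm_of_nonneg (by positivity),
      pow_mul, sq_abs, mul_pow, add_zero]
    have h1 : ((n : ℝ) ^ 2) ^ (k + 1) ≠ 0 := by simpa using hn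
    field_simp

lemma mellinConvergent_thetaMoment_succ (k : ℕ) {w : ℂ} (hw : k + 2 < w.re) :
    MellinConvergent (fun t ↦ (thetaMoment (k + 1) t : ℂ)) w := by
  have hc : ContinuousOn (fun t ↦ (thetaMoment (k + 1) t : ℂ)) (Ioi 0) := fun t ht ↦
    (continuous_ofReal.continuousAt.comp
      (hasDerivAt_thetaMoment (k + 1) ht).continuousAt).continuousWithinAt
  exact mellinConvergent_of_isBigO_rpow (hc.locallyIntegrableOn measurableSet_Ioi)
    (isBigO_ofReal_left.2 (thetaMoment_succ_isBigO_atTop k (-(w.re + 1)))) (lt_add_one _)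
    (isBigO_ofReal_left.2 (thetaMoment_succ_isBigO_zero k)) hw

lemma mellin_xiKernel_eq_xi_of_two_lt_re {s : ℂ} (hs : 2 < s.re) :
    mellin (fun t ↦ (xiKernel t : ℂ)) (s / 2) = xi s := by
  have hre (k : ℕ) : k + 2 < (s / 2 + (k + 1 : ℕ)).re := by
    simp only [add_re, div_ofNat_re, natCast_re]
    push_cast
    linarith
  have hconv (k : ℕ) := MellinConvergent.cpow_smul.2 (mellinConvergent_thetaMoment_succ k (hre k))
  have hval (k : ℕ) := Gammaℝ_mul_mellin_thetaMoment_succ k (one_lt_two.trans hs)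
  have hsub := (hasMellin_sub (hconv 1) ((hconv 0).const_smul (3 / 2 : ℂ))).2
  rw [mellin_const_smul, mellin_cpow_smul, mellin_cpow_smul] at hsub
  have hs0 : s ≠ 0 := fun h ↦ by norm_num [h] at hs
  have hs1 : s ≠ 1 := fun h ↦ by norm_num [h] at hs
  have hs2 : s + 2 ≠ 0 := fun h ↦ by
    have := congrArg re h
    simp only [add_re, re_ofNat, zero_re] at this
    linarith
  have hG : Gammaℝ s ≠ 0 := Gammaℝ_ne_zero_of_re_pos (by linarith)
  have hpi : (Real.pi : ℂ) ≠ 0 := ofReal_ne_zero.2 Real.pi_ne_zero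
  have h0 : mellin (fun t ↦ (thetaMoment (0 + 1) t : ℂ)) (s / 2 + (0 + 1 : ℕ)) =
      s * completedRiemannZeta s := by
    refine mul_left_cancel₀ hG ((hval 0).trans ?_)
    simp only [zero_add, Nat.cast_one, mul_one, Gammaℝ_add_two hs0]
    field_simp
  have h1 : mellin (fun t ↦ (thetaMoment (1 + 1) t : ℂ)) (s / 2 + (1 + 1 : ℕ)) =
      s * (s + 2) / 2 * completedRiemannZeta s := by
    refine mul_left_cancel₀ hG ((hval 1).trans ?_)
    rw [show s + 2 * (1 + 1 : ℕ) = s + 2 + 2 by push_cast; ring, Gammaℝ_add_two hs2,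
      Gammaℝ_add_two hs0]
    field_simp
  rw [h0, h1] at hsub
  have hfun : (fun t ↦ (xiKernel t : ℂ)) = fun t : ℝ ↦
      (t : ℂ) ^ ((1 + 1 : ℕ) : ℂ) • (thetaMoment (1 + 1) t : ℂ) -
        (3 / 2 : ℂ) • (t : ℂ) ^ ((0 + 1 : ℕ) : ℂ) • (thetaMoment (0 + 1) t : ℂ) := by
    funext t
    simp only [cpow_natCast, smul_eq_mul, xiKernel]
    push_cast
    ring
  rw [hfun, hsub, xi, completedRiemannZeta_eq]
  have : 1 - s ≠ 0 := sub_ne_zero.2 hs1.symm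
  simp only [smul_eq_mul]
  field_simp
  ring

lemma log_pow_mul_xiKernel_locallyIntegrableOn (k : ℕ) :
    LocallyIntegrableOn (fun t ↦ ((Real.log t ^ k * xiKernel t : ℝ) : ℂ)) (Ioi 0) := by
  refine ContinuousOn.locallyIntegrableOn ?_ measurableSet_Ioi
  exact continuous_ofReal.comp_continuousOn (((Real.continuousOn_log.mono fun t ht ↦
    (mem_Ioi.1 ht).ne').pow k).mul continuousOn_xiKernel)

lemma log_pow_mul_xiKernel_isBigO_atTop (k : ℕ) (r : ℝ) :
    (fun t ↦ Real.log t ^ k * xiKernel t) =O[atTop] fun t ↦ t ^ r := by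
  induction k generalizing r with
  | zero => simpa using xiKernel_isBigO_atTop r
  | succ k ih =>
    refine ((isLittleO_log_rpow_atTop one_pos).isBigO.mul (ih (r - 1))).congr'
      (.of_forall fun t ↦ by ring) ?_
    filter_upwards [eventually_gt_atTop 0] with t ht
    rw [← Real.rpow_add ht, add_sub_cancel]

lemma log_pow_mul_xiKernel_isBigO_zero (k : ℕ) (r : ℝ) :
    (fun t ↦ Real.log t ^ k * xiKernel t) =O[𝓝[>] 0] fun t ↦ t ^ r := by
  induction k generalizing r with
  | zero => simpa using xiKernel_isBigO_zero r
  | succ k ih =>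
    refine ((isLittleO_log_rpow_nhdsGT_zero neg_one_lt_zero).isBigO.mul (ih (r + 1))).congr'
      (.of_forall fun t ↦ by ring) ?_
    filter_upwards [self_mem_nhdsWithin] with t ht
    rw [← Real.rpow_add ht, neg_add_cancel_comm_assoc]

lemma mellinConvergent_log_pow_mul_xiKernel (k : ℕ) (w : ℂ) :
    MellinConvergent (fun t ↦ ((Real.log t ^ k * xiKernel t : ℝ) : ℂ)) w :=
  mellinConvergent_of_isBigO_rpow (log_pow_mul_xiKernel_locallyIntegrableOn k)
    (isBigO_ofReal_left.2 (log_pow_mul_xiKernel_isBigO_atTop k (-(w.re + 1)))) (lt_add_one _)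
    (isBigO_ofReal_left.2 (log_pow_mul_xiKernel_isBigO_zero k (-(w.re - 1)))) (sub_one_lt _)

lemma hasDerivAt_mellin_log_pow_mul_xiKernel (k : ℕ) (w : ℂ) :
    HasDerivAt (mellin fun t ↦ ((Real.log t ^ k * xiKernel t : ℝ) : ℂ))
      (mellin (fun t ↦ ((Real.log t ^ (k + 1) * xiKernel t : ℝ) : ℂ)) w) w := by
  convert! (mellin_hasDerivAt_of_isBigO_rpow (log_pow_mul_xiKernel_locallyIntegrableOn k)
    (isBigO_ofReal_left.2 (log_pow_mul_xiKernel_isBigO_atTop k (-(w.re + 1)))) (lt_add_one _)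
    (isBigO_ofReal_left.2 (log_pow_mul_xiKernel_isBigO_zero k (-(w.re - 1)))) (sub_one_lt _)).2
    using 3
  rw [real_smul]
  push_cast
  ring

lemma differentiable_xi : Differentiable ℂ xi := by
  have := differentiable_completedZeta₀
  unfold xi
  fun_prop

lemma xi_one_sub (s : ℂ) : xi (1 - s) = xi s := by
  rw [xi, xi, completedRiemannZeta₀_one_sub]
  ring

lemma xi_eq_mellin : xi = fun s ↦ mellin (fun t ↦ (xiKernel t : ℂ)) (s / 2) := by
  have hd : Differentiable ℂ fun s ↦ mellin (fun t ↦ (xiKernel t : ℂ)) (s / 2) := fun s ↦ by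
    have h := (hasDerivAt_mellin_log_pow_mul_xiKernel 0 (s / 2)).differentiableAt
    simp only [pow_zero, one_mul] at h
    exact DifferentiableAt.comp s (g := mellin fun t ↦ (xiKernel t : ℂ)) h
      (differentiableAt_id.div_const (2 : ℂ))
  refine AnalyticOnNhd.eq_of_eventuallyEq (z₀ := 3)
    (differentiable_xi.differentiableOn.analyticOnNhd isOpen_univ)
    (hd.differentiableOn.analyticOnNhd isOpen_univ) ?_
  filter_upwards [(isOpen_lt continuous_const continuous_re).mem_nhds
    (show (2 : ℝ) < (3 : ℂ).re by norm_num)] with s hs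
  exact (mellin_xiKernel_eq_xi_of_two_lt_re hs).symm

lemma iteratedDeriv_xi (k : ℕ) : iteratedDeriv k xi = fun s ↦
    (1 / 2) ^ k * mellin (fun t ↦ ((Real.log t ^ k * xiKernel t : ℝ) : ℂ)) (s / 2) := by
  induction k with
  | zero => simp [xi_eq_mellin]
  | succ k ih =>
    rw [iteratedDeriv_succ, ih]
    funext s
    refine (((hasDerivAt_mellin_log_pow_mul_xiKernel k (s / 2)).comp s
      ((hasDerivAt_id s).div_const 2)).const_mul ((1 / 2 : ℂ) ^ k)).deriv.trans ?_
    ring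

/-- The derivatives of `ξ` at `1/2` are the logarithmic moments of `xiKernel`. -/
lemma iteratedDeriv_xi_half (k : ℕ) : iteratedDeriv k xi (1 / 2) =
    (((1 / 2) ^ k *
      ∫ t in Ioi (0 : ℝ), t ^ (-(3 / 4) : ℝ) * (Real.log t ^ k * xiKernel t) : ℝ) : ℂ) := by
  rw [iteratedDeriv_xi, ofReal_mul, ← integral_complex_ofReal]
  push_cast
  congr 1
  refine setIntegral_congr_fun measurableSet_Ioi fun t ht ↦ ?_
  simp only [smul_eq_mul]
  rw [ofReal_cpow (mem_Ioi.1 ht).le]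
  push_cast
  norm_num

lemma integrableOn_rpow_mul_log_pow_mul_xiKernel (k : ℕ) :
    IntegrableOn (fun t : ℝ ↦ t ^ (-(3 / 4) : ℝ) * (Real.log t ^ k * xiKernel t)) (Ioi 0) := by
  have h := Integrable.re (mellinConvergent_log_pow_mul_xiKernel k (1 / 4))
  refine IntegrableOn.congr_fun (f := fun t : ℝ ↦
    RCLike.re ((t : ℂ) ^ ((1 / 4 : ℂ) - 1) • ((Real.log t ^ k * xiKernel t : ℝ) : ℂ))) h
    (fun t ht ↦ ?_) measurableSet_Ioi
  have : (1 / 4 : ℂ) - 1 = ((-(3 / 4) : ℝ) : ℂ) := by push_cast; norm_num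
  simp only [this, ← ofReal_cpow (mem_Ioi.1 ht).le, smul_eq_mul, ← ofReal_mul]
  exact ofReal_re _

lemma integral_log_even_pow_mul_xiKernel_pos (r : ℕ) :
    0 < ∫ t in Ioi (0 : ℝ), t ^ (-(3 / 4) : ℝ) * (Real.log t ^ (2 * r) * xiKernel t) := by
  rw [setIntegral_pos_iff_support_of_nonneg_ae ?_ (integrableOn_rpow_mul_log_pow_mul_xiKernel _)]
  · refine lt_of_lt_of_le ?_ (measure_mono (s := Ioi (1 : ℝ)) fun t ht ↦ ?_)
    · simp
    · have ht0 : (0 : ℝ) < t := one_pos.trans ht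
      exact ⟨(mul_pos (Real.rpow_pos_of_pos ht0 _)
        (mul_pos (pow_pos (Real.log_pos ht) _) (xiKernel_pos ht0))).ne', ht0⟩
  · filter_upwards [ae_restrict_mem measurableSet_Ioi] with t ht
    exact mul_nonneg (Real.rpow_nonneg (mem_Ioi.1 ht).le _)
      (mul_nonneg ((even_two_mul r).pow_nonneg _) (xiKernel_pos ht).le)

end Theta

/-- Pustyl'nikov's Theorem 1: every even-order derivative of `ξ` at `1/2` is a
positive real, and every odd-order derivative of `ξ` at `1/2` vanishes. -/
theorem xi_derivs_at_half :
    (∀ r : ℕ, (iteratedDeriv (2 * r) xi (1 / 2)).im = 0 ∧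
      0 < (iteratedDeriv (2 * r) xi (1 / 2)).re) ∧
    (∀ k : ℕ, Odd k → iteratedDeriv k xi (1 / 2) = 0) := by
  refine ⟨fun r ↦ ?_, fun k hk ↦ ?_⟩
  · rw [iteratedDeriv_xi_half, ofReal_im, ofReal_re]
    exact ⟨rfl, mul_pos (by positivity) (integral_log_even_pow_mul_xiKernel_pos r)⟩
  · have h := congrFun (iteratedDeriv_comp_const_sub (n := k) (f := xi) (s := (1 : ℂ))) (1 / 2)
    rw [funext xi_one_sub, hk.neg_one_pow] at h
    norm_num at h
    exact self_eq_neg.1 (by norm_num; exact h)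
end

section
/- For every natural number r ≥ 1, ξ_r = (2^{−(2r+2)}/(2r)!) · ∫_1^∞ (log x)^{2r−2} · (16·(2r)·(2r−1) − (log x)^2) · x^{−3/4} · ω(x) dx, where ω(x) = Σ_{n=1}^∞ exp(−π n² x). -/
open Complex

/-- `ω(x) = Σ_{n=1}^∞ exp(−π n² x)`. -/
noncomputable def omegaFn (x : ℝ) : ℝ := ∑' n : ℕ, Real.exp (-Real.pi * ((n : ℝ) + 1) ^ 2 * x)

open MeasureTheory Set Filter Asymptotics Topology in
theorem mellin_log_pow_of_rapidDecay {f : ℝ → ℂ} (hf : LocallyIntegrableOn f (Ioi 0))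
    (htop : ∀ a : ℝ, f =O[atTop] (· ^ a)) (hzero : ∀ a : ℝ, f =O[𝓝[>] 0] (· ^ a)) (n : ℕ) (s : ℂ) :
    MellinConvergent (fun t ↦ Real.log t ^ n • f t) s ∧
      HasDerivAt (mellin fun t ↦ Real.log t ^ n • f t)
        (mellin (fun t ↦ Real.log t ^ (n + 1) • f t) s) s := by
  have hint (m : ℕ) : LocallyIntegrableOn (fun t ↦ Real.log t ^ m • f t) (Ioi 0) := by
    refine hf.continuousOn_smul isOpen_Ioi.isLocallyClosed ?_
    exact (Real.continuousOn_log.mono fun x hx ↦ ne_of_gt hx).pow m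
  have htop' (m : ℕ) : ∀ a : ℝ, (fun t ↦ Real.log t ^ m • f t) =O[atTop] (· ^ (-a)) := by
    induction m with
    | zero => intro a; simpa using htop (-a)
    | succ m ih =>
      intro a
      simpa only [pow_succ', mul_smul] using isBigO_rpow_top_log_smul (lt_add_one a) (ih (a + 1))
  have hzero' (m : ℕ) : ∀ a : ℝ, (fun t ↦ Real.log t ^ m • f t) =O[𝓝[>] 0] (· ^ (-a)) := by
    induction m with
    | zero => intro a; simpa using hzero (-a)
    | succ m ih =>
      intro a
      simpa only [pow_succ', mul_smul] using isBigO_rpow_zero_log_smul (sub_one_lt a) (ih (a - 1))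
  have hs := lt_add_one s.re
  have hs' := sub_one_lt s.re
  refine ⟨mellinConvergent_of_isBigO_rpow (hint n) (htop' n _) hs (hzero' n _) hs', ?_⟩
  simpa only [pow_succ', mul_smul] using
    (mellin_hasDerivAt_of_isBigO_rpow (hint n) (htop' n _) hs (hzero' n _) hs').2

/-- The Mellin kernel of `completedRiemannZeta₀`, a strong functional equation pair. -/
noncomputable abbrev thetaPair : WeakFEPair ℂ := (HurwitzZeta.hurwitzEvenFEPair 0).toStrongFEPair

theorem thetaPair_mellin_log_pow (n : ℕ) (s : ℂ) :
    MellinConvergent (fun t ↦ Real.log t ^ n • thetaPair.f t) s ∧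
      HasDerivAt (mellin fun t ↦ Real.log t ^ n • thetaPair.f t)
        (mellin (fun t ↦ Real.log t ^ (n + 1) • thetaPair.f t) s) s :=
  have h := (HurwitzZeta.hurwitzEvenFEPair 0).isStrongFEPair_toStrongFEPair
  mellin_log_pow_of_rapidDecay thetaPair.hf_int h.hf_top h.hf_zero n s

theorem iteratedDeriv_completedRiemannZeta₀ (n : ℕ) :
    iteratedDeriv n completedRiemannZeta₀ =
      fun s ↦ (1 / 2) ^ n * mellin (fun t ↦ Real.log t ^ n • thetaPair.f t) (s / 2) / 2 := by
  induction n with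
  | zero => ext s; simp; rfl
  | succ n ih =>
    ext s
    rw [iteratedDeriv_succ, ih]
    have h := (thetaPair_mellin_log_pow n (s / 2)).2.comp s ((hasDerivAt_id s).div_const 2)
    refine (((h.const_mul ((1 / 2) ^ n)).div_const 2).congr_deriv ?_).deriv
    ring

theorem iteratedDeriv_quadratic_mul {F : ℂ → ℂ} (hF : Differentiable ℂ F) (n : ℕ) :
    iteratedDeriv (n + 2) (fun s ↦ s * (s - 1) / 2 * F s + 1 / 2) =
      fun s ↦ s * (s - 1) / 2 * iteratedDeriv (n + 2) F s +
        (n + 2) * (s - 1 / 2) * iteratedDeriv (n + 1) F s +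
        (n + 2) * (n + 1) / 2 * iteratedDeriv n F s := by
  have hd (m : ℕ) (s : ℂ) : HasDerivAt (iteratedDeriv m F) (iteratedDeriv (m + 1) F s) s := by
    rw [iteratedDeriv_succ]
    exact ((hF.contDiff (n := ⊤)).differentiable_iteratedDeriv m
      (WithTop.coe_lt_top _) s).hasDerivAt
  have hq (s : ℂ) : HasDerivAt (fun s : ℂ ↦ s * (s - 1) / 2) (s - 1 / 2) s :=
    (((hasDerivAt_id s).mul ((hasDerivAt_id s).sub_const 1)).div_const 2).congr_deriv
      (by simp; ring)
  have hl (s : ℂ) : HasDerivAt (fun s : ℂ ↦ s - 1 / 2) 1 s := (hasDerivAt_id s).sub_const _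
  induction n with
  | zero =>
    have h1 : deriv (fun s ↦ s * (s - 1) / 2 * F s + 1 / 2) = fun s ↦
        (s - 1 / 2) * iteratedDeriv 0 F s + s * (s - 1) / 2 * iteratedDeriv 1 F s := by
      ext s
      simpa using (((hq s).mul (hd 0 s)).add_const (1 / 2)).deriv
    ext s
    rw [iteratedDeriv_succ, iteratedDeriv_one, h1]
    refine ((((hl s).mul (hd 0 s)).add ((hq s).mul (hd 1 s))).congr_deriv ?_).deriv
    push_cast
    ring
  | succ n ih =>
    ext s
    rw [iteratedDeriv_succ, ih]
    refine (((((hq s).mul (hd (n + 2) s)).add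
      (((hl s).const_mul (n + 2 : ℂ)).mul (hd (n + 1) s))).add
      ((hd n s).const_mul ((n + 2 : ℂ) * (n + 1) / 2))).congr_deriv ?_).deriv
    push_cast
    ring

open MeasureTheory Set in
theorem mellin_quarter_of_symmetric {φ : ℝ → ℂ} (hφ : MellinConvergent φ (1 / 4))
    (hone : φ 1 = 0)
    (hsymm : ∀ x : ℝ, 0 < x → φ x⁻¹ = (x : ℂ) ^ (1 / 2 : ℂ) * φ x) :
    mellin φ (1 / 4) = 2 * ∫ x in Ioi (1 : ℝ), (x : ℂ) ^ (-(3 / 4) : ℂ) * φ x := by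
  set ψ : ℝ → ℂ := (Ioi 1).indicator φ
  have hsub : Ioi (1 : ℝ) ⊆ Ioi 0 := Ioi_subset_Ioi zero_le_one
  have hψ : MellinConvergent ψ (1 / 4) := by
    have h := (hφ.indicator (measurableSet_Ioi (a := (1 : ℝ))))
    refine h.congr_fun (fun x _ ↦ ?_) measurableSet_Ioi
    by_cases hx : x ∈ Ioi (1 : ℝ) <;> simp [ψ, hx]
  have hψ_int : mellin ψ (1 / 4) = ∫ x in Ioi (1 : ℝ), (x : ℂ) ^ (-(3 / 4) : ℂ) * φ x := by
    rw [← inter_eq_right.mpr hsub, ← setIntegral_indicator measurableSet_Ioi]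
    refine setIntegral_congr_fun measurableSet_Ioi fun x _ ↦ ?_
    by_cases hx : x ∈ Ioi (1 : ℝ)
    · simp only [ψ, indicator_of_mem hx, smul_eq_mul]
      norm_num
    · simp [ψ, hx]
  have hinv : MellinConvergent (fun x : ℝ ↦ (x : ℂ) ^ (-(1 / 2) : ℂ) • ψ x⁻¹) (1 / 4) := by
    rw [MellinConvergent.cpow_smul]
    simp_rw [← Real.rpow_neg_one]
    rw [MellinConvergent.comp_rpow (by norm_num)]
    convert hψ using 1
    push_cast
    norm_num
  have hinv_eq : mellin (fun x : ℝ ↦ (x : ℂ) ^ (-(1 / 2) : ℂ) • ψ x⁻¹) (1 / 4) =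
      mellin ψ (1 / 4) := by
    rw [mellin_cpow_smul, mellin_comp_inv]
    norm_num
  have hsplit : mellin φ (1 / 4) =
      mellin (fun x ↦ ψ x + (x : ℂ) ^ (-(1 / 2) : ℂ) • ψ x⁻¹) (1 / 4) := by
    refine setIntegral_congr_fun measurableSet_Ioi fun x (hx : 0 < x) ↦ ?_
    simp only
    congr 1
    rcases lt_trichotomy x 1 with h | rfl | h
    · have h' : x⁻¹ ∈ Ioi (1 : ℝ) := (one_lt_inv₀ hx).mpr h
      have h'' : x ∉ Ioi (1 : ℝ) := notMem_Ioi.mpr h.le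
      have hne : (x : ℂ) ≠ 0 := by exact_mod_cast hx.ne'
      simp only [ψ, indicator_of_mem h', indicator_of_notMem h'', hsymm x hx, smul_eq_mul, zero_add]
      rw [← mul_assoc, ← Complex.cpow_add _ _ hne]
      simp
    · simp [ψ, hone]
    · have h' : x⁻¹ ∉ Ioi (1 : ℝ) := notMem_Ioi.mpr (inv_le_one_of_one_le₀ h.le)
      simp [ψ, h', mem_Ioi.mpr h]
  rw [hsplit, (hasMellin_add hψ hinv).2, hinv_eq, hψ_int]
  ring

theorem thetaPair_f_of_one_lt {x : ℝ} (hx : 1 < x) : thetaPair.f x = (2 * omegaFn x : ℝ) := by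
  have h := (HurwitzZeta.hasSum_nat_cosKernel₀ 0 (zero_lt_one.trans hx)).tsum_eq
  have h0 : ((0 : ℝ) : UnitAddCircle) = 0 := rfl
  simp only [mul_zero, zero_mul, Real.cos_zero, mul_one, tsum_mul_left, h0] at h
  rw [omegaFn, h, ← HurwitzZeta.evenKernel_eq_cosKernel_of_zero]
  simp [thetaPair, WeakFEPair.toStrongFEPair, WeakFEPair.f_modif, hx, hx.le,
    HurwitzZeta.hurwitzEvenFEPair]

open MeasureTheory Set in
theorem iteratedDeriv_completedRiemannZeta₀_half (m : ℕ) :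
    iteratedDeriv (2 * m) completedRiemannZeta₀ (1 / 2) =
      (2 * (1 / 4) ^ m * ∫ x in Ioi (1 : ℝ),
        Real.log x ^ (2 * m) * x ^ (-(3 / 4 : ℝ)) * omegaFn x : ℝ) := by
  have hsymm (x : ℝ) (hx : 0 < x) : Real.log x⁻¹ ^ (2 * m) • thetaPair.f x⁻¹ =
      (x : ℂ) ^ (1 / 2 : ℂ) * Real.log x ^ (2 * m) • thetaPair.f x := by
    have h := thetaPair.h_feq x hx
    have hg : thetaPair.g = thetaPair.f := by
      simp [thetaPair, WeakFEPair.toStrongFEPair]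
    rw [hg, one_div] at h
    rw [h, Real.log_inv, (even_two_mul m).neg_pow]
    simp [thetaPair, WeakFEPair.toStrongFEPair, HurwitzZeta.hurwitzEvenFEPair,
      Complex.ofReal_cpow hx.le]
    ring
  have hone : Real.log 1 ^ (2 * m) • thetaPair.f 1 = 0 := by
    simp [thetaPair, WeakFEPair.toStrongFEPair, WeakFEPair.f_modif]
  have hconv := (thetaPair_mellin_log_pow (2 * m) (1 / 4)).1
  rw [iteratedDeriv_completedRiemannZeta₀]
  simp only
  rw [show (1 / 2 / 2 : ℂ) = 1 / 4 by norm_num, mellin_quarter_of_symmetric hconv hone hsymm]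
  have hint : ∫ x in Ioi (1 : ℝ), (x : ℂ) ^ (-(3 / 4) : ℂ) *
        (Real.log x ^ (2 * m) • thetaPair.f x) =
      ((2 * ∫ x in Ioi (1 : ℝ), Real.log x ^ (2 * m) * x ^ (-(3 / 4 : ℝ)) * omegaFn x : ℝ) : ℂ) := by
    rw [← integral_const_mul, ← integral_complex_ofReal]
    refine setIntegral_congr_fun measurableSet_Ioi fun x (hx : 1 < x) ↦ ?_
    simp only [thetaPair_f_of_one_lt hx, Complex.real_smul]
    push_cast [Complex.ofReal_cpow (zero_le_one.trans hx.le)]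
    ring
  rw [hint, pow_mul]
  push_cast
  norm_num
  ring

open MeasureTheory Set in
theorem integrableOn_log_pow_mul_omegaFn (n : ℕ) :
    IntegrableOn (fun x ↦ Real.log x ^ n * x ^ (-(3 / 4 : ℝ)) * omegaFn x) (Ioi 1) := by
  have h := ((thetaPair_mellin_log_pow n (1 / 4)).1.mono_set
    (Ioi_subset_Ioi zero_le_one)).re.div_const 2
  refine IntegrableOn.congr_fun h (fun x (hx : 1 < x) ↦ ?_) measurableSet_Ioi
  have hx0 := zero_le_one.trans hx.le
  have he : (x : ℂ) ^ (1 / 4 - 1 : ℂ) = (x ^ (-(3 / 4 : ℝ)) : ℝ) := by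
    push_cast [Complex.ofReal_cpow hx0]
    norm_num
  simp only [thetaPair_f_of_one_lt hx, he, Complex.real_smul, smul_eq_mul, ← Complex.ofReal_mul]
  simp only [RCLike.re_to_complex, Complex.ofReal_re]
  ring

/-- Pustyl'nikov's integral representation: for `r ≥ 1`,
`ξ_r = (2^{−(2r+2)}/(2r)!)·∫_1^∞ (log x)^{2r−2}(16·(2r)·(2r−1) − (log x)²) x^{−3/4} ω(x) dx`. -/
theorem xiCoeff_integral_rep (r : ℕ) (hr : 1 ≤ r) :
    xiCoeff r = (((((2 : ℝ) ^ (2 * r + 2))⁻¹ / ((2 * r).factorial : ℝ)) *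
      ∫ x in Set.Ioi (1 : ℝ), (Real.log x) ^ (2 * r - 2) *
        (16 * (2 * r : ℝ) * ((2 * r : ℝ) - 1) - (Real.log x) ^ 2) *
        x ^ (-(3 / 4 : ℝ)) * omegaFn x : ℝ) : ℂ) := by
  obtain ⟨m, rfl⟩ := Nat.exists_eq_add_of_le' hr
  have hsplit : ∫ x in Set.Ioi (1 : ℝ), (Real.log x) ^ (2 * (m + 1) - 2) *
        (16 * (2 * (m + 1 : ℕ) : ℝ) * ((2 * (m + 1 : ℕ) : ℝ) - 1) - (Real.log x) ^ 2) *
        x ^ (-(3 / 4 : ℝ)) * omegaFn x =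
      16 * (2 * m + 2) * (2 * m + 1) *
        (∫ x in Set.Ioi (1 : ℝ), Real.log x ^ (2 * m) * x ^ (-(3 / 4 : ℝ)) * omegaFn x) -
      ∫ x in Set.Ioi (1 : ℝ), Real.log x ^ (2 * (m + 1)) * x ^ (-(3 / 4 : ℝ)) * omegaFn x := by
    rw [← MeasureTheory.integral_const_mul, ← MeasureTheory.integral_sub
      ((integrableOn_log_pow_mul_omegaFn _).const_mul _) (integrableOn_log_pow_mul_omegaFn _)]
    congr 1 with x
    rw [show 2 * (m + 1) - 2 = 2 * m by lia]
    push_cast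
    ring
  have hxi : xi = fun s ↦ s * (s - 1) / 2 * completedRiemannZeta₀ s + 1 / 2 := rfl
  have hpow : (2 : ℂ) ^ (2 * (m + 1) + 2) = 4 ^ m * 16 := by
    rw [show 2 * (m + 1) + 2 = 2 * m + 4 by ring, pow_add, pow_mul]
    norm_num
  rw [hsplit, xiCoeff, hxi, mul_add_one 2 m,
    iteratedDeriv_quadratic_mul differentiable_completedZeta₀, ← mul_add_one 2 m]
  simp only
  rw [iteratedDeriv_completedRiemannZeta₀_half, iteratedDeriv_completedRiemannZeta₀_half]
  have h4 : (4 : ℂ) ^ m ≠ 0 := pow_ne_zero _ (by norm_num)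
  have hfac : ((2 * (m + 1)).factorial : ℂ) ≠ 0 := by exact_mod_cast Nat.factorial_ne_zero _
  push_cast [hpow]
  rw [one_div_pow, one_div_pow]
  field_simp
  ring
end

section
/- The derivative of the Riemann zeta function at 1/2 satisfies ζ'(1/2) = (1/2)·ζ(1/2)·(log π − ψ(1/4)), where ψ(1/4) = Γ'(1/4)/Γ(1/4) is the digamma function evaluated at 1/4. -/
/-- The functional equation of the completed zeta function makes `1 / 2` a critical point. -/
lemma deriv_completedRiemannZeta_one_half : deriv completedRiemannZeta (1 / 2) = 0 := by
  have h : deriv (fun s ↦ completedRiemannZeta (1 - s)) (1 / 2) =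
      deriv completedRiemannZeta (1 / 2) := by
    simp only [completedRiemannZeta_one_sub]
  rw [deriv_comp_const_sub, show (1 : ℂ) - 1 / 2 = 1 / 2 by norm_num] at h
  linear_combination (-1 / 2) * h

/-- The derivative of the complex Gamma function at a positive real is the real derivative. -/
lemma hasDerivAt_complex_Gamma_ofReal {x : ℝ} (hx : 0 < x) :
    HasDerivAt Complex.Gamma ((deriv Real.Gamma x : ℝ) : ℂ) (x : ℂ) := by
  have hC : DifferentiableAt ℂ Complex.Gamma (x : ℂ) := by
    refine Complex.differentiableAt_Gamma _ fun m h ↦ ?_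
    have h' : x = -(m : ℝ) := by exact_mod_cast h
    linarith [(Nat.cast_nonneg m : (0 : ℝ) ≤ m)]
  have hR : DifferentiableAt ℝ Real.Gamma x :=
    Real.differentiableAt_Gamma fun m h ↦ by
      linarith [(Nat.cast_nonneg m : (0 : ℝ) ≤ m)]
  have h₁ := hC.hasDerivAt.comp_ofReal
  simp only [Complex.Gamma_ofReal] at h₁
  rw [← h₁.unique hR.hasDerivAt.ofReal_comp]
  exact hC.hasDerivAt

/-- The derivative at a positive real of the archimedean factor `Gammaℝ`. -/
lemma hasDerivAt_Gammaℝ_ofReal {x : ℝ} (hx : 0 < x) :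
    HasDerivAt Complex.Gammaℝ
      (Complex.Gammaℝ x * (1 / 2) * (((deriv Real.Gamma (x / 2) / Real.Gamma (x / 2) : ℝ) : ℂ) -
        ((Real.log Real.pi : ℝ) : ℂ))) (x : ℂ) := by
  have hG : HasDerivAt (fun s : ℂ ↦ Complex.Gamma (s / 2))
      (((deriv Real.Gamma (x / 2) : ℝ) : ℂ) * (1 / 2)) (x : ℂ) := by
    refine HasDerivAt.comp (x : ℂ) ?_ ((hasDerivAt_id (x : ℂ)).div_const 2)
    have h := hasDerivAt_complex_Gamma_ofReal (half_pos hx)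
    push_cast at h
    exact h
  have hpi : HasDerivAt (fun s : ℂ ↦ (Real.pi : ℂ) ^ (-s / 2))
      ((Real.pi : ℂ) ^ (-(x : ℂ) / 2) * Complex.log Real.pi * (-1 / 2)) (x : ℂ) :=
    ((hasDerivAt_id (x : ℂ)).neg.div_const 2).const_cpow
      (Or.inl (Complex.ofReal_ne_zero.mpr Real.pi_ne_zero))
  have hne : (Real.Gamma (x / 2) : ℂ) ≠ 0 :=
    Complex.ofReal_ne_zero.mpr (Real.Gamma_pos_of_pos (half_pos hx)).ne'
  have hval : Complex.Gamma ((x : ℂ) / 2) = (Real.Gamma (x / 2) : ℂ) := by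
    rw [← Complex.Gamma_ofReal]; push_cast; rfl
  refine (hpi.mul hG).congr_deriv ?_
  rw [Complex.Gammaℝ_def, hval, Complex.ofReal_log Real.pi_pos.le]
  push_cast
  field_simp
  ring

/-- Equation (36): `ζ'(1/2) = (1/2)·ζ(1/2)·(log π − ψ(1/4))`, where `ψ` is the
digamma function, i.e. the logarithmic derivative of the Gamma function. -/
theorem deriv_zeta_half :
    deriv riemannZeta (1 / 2) = (1 / 2) * riemannZeta (1 / 2) *
      (((Real.log Real.pi : ℝ) : ℂ) -
        ((deriv Real.Gamma (1 / 4) / Real.Gamma (1 / 4) : ℝ) : ℂ)) := by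
  have hG := hasDerivAt_Gammaℝ_ofReal (x := 1 / 2) (by norm_num)
  rw [show (1 / 2 : ℝ) / 2 = 1 / 4 by norm_num,
    show ((1 / 2 : ℝ) : ℂ) = 1 / 2 by push_cast; rfl] at hG
  have hne : Complex.Gammaℝ (1 / 2) ≠ 0 := Complex.Gammaℝ_ne_zero_of_re_pos (by norm_num)
  have hΛ : HasDerivAt completedRiemannZeta 0 (1 / 2) := by
    rw [← deriv_completedRiemannZeta_one_half]
    exact (differentiableAt_completedZeta (by norm_num) (by norm_num)).hasDerivAt
  have hζ : riemannZeta =ᶠ[nhds (1 / 2)] fun s ↦ completedRiemannZeta s / Complex.Gammaℝ s := by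
    filter_upwards [isOpen_ne.mem_nhds (show (1 / 2 : ℂ) ≠ 0 by norm_num)] with s hs
    exact riemannZeta_def_of_ne_zero hs
  rw [hζ.deriv_eq, (hΛ.fun_div hG hne).deriv, hζ.eq_of_nhds]
  field_simp
  ring
end
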